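/- arXiv:math/0012209 — 2 statements merged into one kernel-verified Lean document; each statement's English description precedes it below -/
import Mathlib

section
/- Suppose Assumption A holds and 0 < τ̂ < τ < 1. Then there is δ₂ > 0 such that whenever δ(z,λ) ≤ δ₂, Procedure ID0 applied to (z,λ) terminates with B₊ ⊆ A₊ (every strongly active index is placed in the output set A₊, regardless of which optimal solutions of the linear programs are chosen during the procedure). -/
open scoped RealInnerProductSpace
open Metric Set

noncomputable section

/-- Euclidean space ℝ^n. -/
abbrev En (n : ℕ) := EuclideanSpace ℝ (Fin n)

/-- The Lagrangian L(z,λ) = φ(z) + λᵀ g(z). -/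
def Lagr {n m : ℕ} (φ : En n → ℝ) (g : Fin m → En n → ℝ) (z : En n) (l : En m) : ℝ :=
  φ z + ∑ i, l i * g i z

/-- ∇_z L(z,λ). -/
def gradL {n m : ℕ} (φ : En n → ℝ) (g : Fin m → En n → ℝ) (l : En m) (z : En n) : En n :=
  gradient (fun z' => Lagr φ g z' l) z

/-- ∇²_{zz} L(z,λ), as a continuous linear map. -/
def hessL {n m : ℕ} (φ : En n → ℝ) (g : Fin m → En n → ℝ) (l : En m) (z : En n) :
    En n →L[ℝ] En n :=
  fderiv ℝ (gradL φ g l) z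

/-- The KKT conditions at a point z with multiplier λ. -/
def KKTat {n m : ℕ} (φ : En n → ℝ) (g : Fin m → En n → ℝ) (z : En n) (l : En m) : Prop :=
  gradL φ g l z = 0 ∧ (∀ i, g i z ≤ 0) ∧ (∀ i, 0 ≤ l i) ∧ ∑ i, l i * g i z = 0

/-- The set S_λ of optimal multipliers at z*. -/
def Slam {n m : ℕ} (φ : En n → ℝ) (g : Fin m → En n → ℝ) (zs : En n) : Set (En m) :=
  {l | KKTat φ g zs l}

/-- The active set B. -/
def ActB {n m : ℕ} (g : Fin m → En n → ℝ) (zs : En n) : Set (Fin m) := {i | g i zs = 0}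

/-- Strongly active constraints B₊. -/
def Bplus {n m : ℕ} (φ : En n → ℝ) (g : Fin m → En n → ℝ) (zs : En n) : Set (Fin m) :=
  {i | g i zs = 0 ∧ ∃ l ∈ Slam φ g zs, 0 < l i}

/-- Weakly active constraints B₀ = B \ B₊. -/
def Bzero {n m : ℕ} (φ : En n → ℝ) (g : Fin m → En n → ℝ) (zs : En n) : Set (Fin m) :=
  ActB g zs \ Bplus φ g zs

/-- Mangasarian–Fromovitz constraint qualification at z*. -/
def MFCQ {n m : ℕ} (g : Fin m → En n → ℝ) (zs : En n) : Prop :=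
  ∃ y : En n, ∀ i ∈ ActB g zs, ⟪gradient (g i) zs, y⟫ < 0

/-- The second-order sufficient condition. -/
def SOC {n m : ℕ} (φ : En n → ℝ) (g : Fin m → En n → ℝ) (zs : En n) : Prop :=
  ∃ σ : ℝ, 0 < σ ∧ ∀ l ∈ Slam φ g zs, ∀ w : En n,
    (∀ i ∈ Bplus φ g zs, ⟪gradient (g i) zs, w⟫ = 0) →
    (∀ i ∈ Bzero φ g zs, ⟪gradient (g i) zs, w⟫ ≤ 0) →
    σ * ‖w‖ ^ 2 ≤ ⟪w, hessL φ g l zs w⟫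

/-- φ and g twice Lipschitz continuously differentiable near z*. -/
def Smooth2 {n m : ℕ} (φ : En n → ℝ) (g : Fin m → En n → ℝ) (zs : En n) : Prop :=
  ∃ U ∈ nhds zs, ContDiffOn ℝ 2 φ U ∧ (∀ i, ContDiffOn ℝ 2 (g i) U) ∧
    ∃ K : NNReal, LipschitzOnWith K (fun z => fderiv ℝ (fderiv ℝ φ) z) U ∧
      ∀ i, LipschitzOnWith K (fun z => fderiv ℝ (fderiv ℝ (g i)) z) U

/-- Assumption A: smoothness, KKT, MFCQ and the second-order condition hold at z*. -/
def AssumpA {n m : ℕ} (φ : En n → ℝ) (g : Fin m → En n → ℝ) (zs : En n) : Prop :=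
  Smooth2 φ g zs ∧ (∃ l : En m, KKTat φ g zs l) ∧ MFCQ g zs ∧ SOC φ g zs

/-- δ(z,λ) = dist((z,λ), S) where S = {z*} × S_λ (Euclidean product norm). -/
def deltaP {n m : ℕ} (φ : En n → ℝ) (g : Fin m → En n → ℝ) (zs : En n)
    (z : En n) (l : En m) : ℝ :=
  Real.sqrt (‖z - zs‖ ^ 2 + (Metric.infDist l (Slam φ g zs)) ^ 2)

/-- η(z,λ) = ‖(∇_z L(z,λ), min(λ, −g(z)))‖. -/
def eta {n m : ℕ} (φ : En n → ℝ) (g : Fin m → En n → ℝ) (z : En n) (l : En m) : ℝ :=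
  Real.sqrt (‖gradL φ g l z‖ ^ 2 + ∑ i, (min (l i) (-(g i z))) ^ 2)

/-- The estimated active set A(z,λ) = {i : g_i(z) ≥ −η(z,λ)^τ}. -/
def Aest {n m : ℕ} (φ : En n → ℝ) (g : Fin m → En n → ℝ) (τ : ℝ) (z : En n) (l : En m) :
    Set (Fin m) :=
  {i | -(eta φ g z l) ^ τ ≤ g i z}

/-- Feasibility for the linear program LP(Â) (independent of Â): componentwise bounds on
∇φ(z) + Σ_i λ̃_i ∇g_i(z), nonnegativity on A(z,λ), and λ̃_i = 0 off A(z,λ). -/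
def LPFeasible {n m : ℕ} (φ : En n → ℝ) (g : Fin m → En n → ℝ) (τ : ℝ)
    (z : En n) (l : En m) (lt : En m) : Prop :=
  (∀ j : Fin n, |(gradient φ z + ∑ i, lt i • gradient (g i) z) j| ≤ (eta φ g z l) ^ τ) ∧
  (∀ i ∈ Aest φ g τ z l, 0 ≤ lt i) ∧ (∀ i ∉ Aest φ g τ z l, lt i = 0)

/-- The objective Σ_{i ∈ Â} λ̃_i of LP(Â). -/
def lpObj {m : ℕ} (Ah : Set (Fin m)) (lt : En m) : ℝ :=
  ∑ i, Ah.indicator (fun i => lt i) i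

/-- λ̃ is an optimal solution of LP(Â). -/
def LPOptimal {n m : ℕ} (φ : En n → ℝ) (g : Fin m → En n → ℝ) (τ : ℝ)
    (z : En n) (l : En m) (Ah : Set (Fin m)) (lt : En m) : Prop :=
  LPFeasible φ g τ z l lt ∧ ∀ lt', LPFeasible φ g τ z l lt' → lpObj Ah lt' ≤ lpObj Ah lt

/-- The initial working set Â_init of Procedure ID0. -/
def initSet {n m : ℕ} (φ : En n → ℝ) (g : Fin m → En n → ℝ) (τ th : ℝ)
    (z : En n) (l : En m) : Set (Fin m) :=
  Aest φ g τ z l \ {i | (eta φ g z l) ^ th ≤ l i}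

/-- One pass of the repeat loop of Procedure ID0 that does not stop:
an optimal solution λ̃ of LP(Â) is chosen, C = {i ∈ Â : λ̃_i ≥ η^τ̂} is nonempty,
and the working set is updated to Â \ C. -/
def ID0Step {n m : ℕ} (φ : En n → ℝ) (g : Fin m → En n → ℝ) (τ th : ℝ)
    (z : En n) (l : En m) (Ah Ah' : Set (Fin m)) : Prop :=
  ∃ lt, LPOptimal φ g τ z l Ah lt ∧
    {i | i ∈ Ah ∧ (eta φ g z l) ^ th ≤ lt i} ≠ ∅ ∧
    Ah' = Ah \ {i | i ∈ Ah ∧ (eta φ g z l) ^ th ≤ lt i}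

/-- (A₀, A₊) is a possible output of Procedure ID0 on input (z,λ). -/
def ID0Out {n m : ℕ} (φ : En n → ℝ) (g : Fin m → En n → ℝ) (τ th : ℝ)
    (z : En n) (l : En m) (A0 Ap : Set (Fin m)) : Prop :=
  ∃ Ah : Set (Fin m),
    Relation.ReflTransGen (ID0Step φ g τ th z l) (initSet φ g τ th z l) Ah ∧
    ((∃ lt, LPOptimal φ g τ z l Ah lt ∧
        {i | i ∈ Ah ∧ (eta φ g z l) ^ th ≤ lt i} = ∅ ∧
        A0 = Ah ∧ Ap = Aest φ g τ z l \ Ah) ∨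
     (∃ lt, LPOptimal φ g τ z l Ah lt ∧
        {i | i ∈ Ah ∧ (eta φ g z l) ^ th ≤ lt i} ≠ ∅ ∧
        Ah \ {i | i ∈ Ah ∧ (eta φ g z l) ^ th ≤ lt i} = ∅ ∧
        A0 = ∅ ∧ Ap = Aest φ g τ z l))

/-- Feasibility for the linear program (intlam). -/
def IntFeasible {n m : ℕ} (φ : En n → ℝ) (g : Fin m → En n → ℝ) (τ : ℝ)
    (z : En n) (l : En m) (Ap : Set (Fin m)) (t : ℝ) (lh : En m) : Prop :=
  (∀ i ∈ Ap, t ≤ lh i) ∧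
  (∀ j : Fin n, |(gradient φ z + ∑ i, lh i • gradient (g i) z) j| ≤ (eta φ g z l) ^ τ) ∧
  (∀ i ∈ Ap, 0 ≤ lh i) ∧ (∀ i ∉ Ap, lh i = 0)

/-- (t̂, λ̂) is an optimal solution of (intlam). -/
def IntOptimal {n m : ℕ} (φ : En n → ℝ) (g : Fin m → En n → ℝ) (τ : ℝ)
    (z : En n) (l : En m) (Ap : Set (Fin m)) (t : ℝ) (lh : En m) : Prop :=
  IntFeasible φ g τ z l Ap t lh ∧
  ∀ t' lh', IntFeasible φ g τ z l Ap t' lh' → t' ≤ t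

/-- ε_λ = max_{λ* ∈ S_λ} min_{i ∈ B₊} λ*_i. -/
def epsLam {n m : ℕ} (φ : En n → ℝ) (g : Fin m → En n → ℝ) (zs : En n) : ℝ :=
  ⨆ l ∈ Slam φ g zs, ⨅ i ∈ Bplus φ g zs, l i

/-- S_λ^ν = {λ ∈ S_λ : min_{i∈B₊} λ_i ≥ ν ε_λ}. -/
def SlamNu {n m : ℕ} (φ : En n → ℝ) (g : Fin m → En n → ℝ) (zs : En n) (ν : ℝ) :
    Set (En m) :=
  {l ∈ Slam φ g zs | ∀ i ∈ Bplus φ g zs, ν * epsLam φ g zs ≤ l i}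

/-- (Δz, λ⁺) solves the stabilized SQP subproblem at (z,λ) with parameter μ. -/
def SSQPSol {n m : ℕ} (φ : En n → ℝ) (g : Fin m → En n → ℝ)
    (z : En n) (l : En m) (μ : ℝ) (dz : En n) (lp : En m) : Prop :=
  hessL φ g l z dz + gradient φ z + ∑ i, lp i • gradient (g i) z = 0 ∧
  (∀ i, 0 ≤ lp i) ∧
  (∀ i, g i z + ⟪gradient (g i) z, dz⟫ - μ * (lp i - l i) ≤ 0) ∧
  ∑ i, lp i * (g i z + ⟪gradient (g i) z, dz⟫ - μ * (lp i - l i)) = 0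

/-- Euclidean distance between primal-dual pairs. -/
def pdist {n m : ℕ} (p q : En n × En m) : ℝ :=
  Real.sqrt (‖p.1 - q.1‖ ^ 2 + ‖p.2 - q.2‖ ^ 2)

open Filter Topology

section

variable {n m : ℕ} {φ : En n → ℝ} {g : Fin m → En n → ℝ} {zs : En n}

theorem ContDiffAt.differentiableAt_gradient {f : En n → ℝ} {x : En n}
    (hf : ContDiffAt ℝ 2 f x) : DifferentiableAt ℝ (gradient f) x := by
  have h : DifferentiableAt ℝ (fderiv ℝ f) x :=
    (hf.fderiv_right (m := 1) (by norm_num)).differentiableAt (by norm_num)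
  exact (InnerProductSpace.toDual ℝ (En n)).symm.toContinuousLinearEquiv.differentiableAt.comp x h

theorem ContDiffAt.eventually_differentiableAt {f : En n → ℝ} {x : En n}
    (hf : ContDiffAt ℝ 2 f x) : ∀ᶠ y in 𝓝 x, DifferentiableAt ℝ f y :=
  (hf.eventually (by simp)).mono fun _ hy => hy.differentiableAt (by norm_num)

theorem Smooth2.contDiffAt (h : Smooth2 φ g zs) :
    ContDiffAt ℝ 2 φ zs ∧ ∀ i, ContDiffAt ℝ 2 (g i) zs := by
  obtain ⟨U, hU, hφ, hg, -⟩ := h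
  exact ⟨hφ.contDiffAt hU, fun i => (hg i).contDiffAt hU⟩

theorem gradL_eq (l : En m) {z : En n} (hφ : DifferentiableAt ℝ φ z)
    (hg : ∀ i, DifferentiableAt ℝ (g i) z) :
    gradL φ g l z = gradient φ z + ∑ i, l i • gradient (g i) z := by
  refine HasGradientAt.gradient ?_
  rw [hasGradientAt_iff_hasFDerivAt]
  simp only [map_add, map_sum, map_smul]
  have h1 := hφ.hasGradientAt.hasFDerivAt
  have h2 : ∀ i ∈ Finset.univ, HasFDerivAt (fun y => l i * g i y)
      (l i • InnerProductSpace.toDual ℝ (En n) (gradient (g i) z)) z := fun i _ =>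
    ((hg i).hasGradientAt.hasFDerivAt).const_mul (l i)
  exact h1.add (HasFDerivAt.fun_sum h2)

theorem eventually_gradL_eq (hφ : ContDiffAt ℝ 2 φ zs) (hg : ∀ i, ContDiffAt ℝ 2 (g i) zs) :
    ∀ᶠ z in 𝓝 zs, ∀ l : En m,
      gradL φ g l z = gradient φ z + ∑ i, l i • gradient (g i) z := by
  filter_upwards [hφ.eventually_differentiableAt,
    eventually_all.2 fun i => (hg i).eventually_differentiableAt] with z h1 h2 l
  exact gradL_eq l h1 h2

theorem hessL_apply (hφ : ContDiffAt ℝ 2 φ zs) (hg : ∀ i, ContDiffAt ℝ 2 (g i) zs)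
    (l : En m) (w : En n) :
    hessL φ g l zs w =
      fderiv ℝ (gradient φ) zs w + ∑ i, l i • fderiv ℝ (gradient (g i)) zs w := by
  have h : gradL φ g l =ᶠ[𝓝 zs] fun z => gradient φ z + ∑ i, l i • gradient (g i) z :=
    (eventually_gradL_eq hφ hg).mono fun z hz => hz l
  have hs : ∀ i ∈ Finset.univ, HasFDerivAt (fun z => l i • gradient (g i) z)
      (l i • fderiv ℝ (gradient (g i)) zs) zs := fun i _ =>
    ((hg i).differentiableAt_gradient.hasFDerivAt).const_smul (l i)
  have := hφ.differentiableAt_gradient.hasFDerivAt.add (HasFDerivAt.fun_sum hs)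
  rw [hessL, h.fderiv_eq]
  erw [this.fderiv]
  simp

theorem KKTat.mul_constraint_eq_zero {z : En n} {l : En m} (h : KKTat φ g z l) (i : Fin m) :
    l i * g i z = 0 :=
  (Finset.sum_eq_zero_iff_of_nonpos
    fun j _ => mul_nonpos_of_nonneg_of_nonpos (h.2.2.1 j) (h.2.1 j)).1 h.2.2.2 i
    (Finset.mem_univ i)

theorem KKTat.eq_zero_of_inactive {z : En n} {l : En m} (h : KKTat φ g z l) {i : Fin m}
    (hi : g i z ≠ 0) : l i = 0 :=
  (mul_eq_zero.1 (h.mul_constraint_eq_zero i)).resolve_right hi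

theorem isCompact_Slam (hφ : DifferentiableAt ℝ φ zs) (hg : ∀ i, DifferentiableAt ℝ (g i) zs)
    (hM : MFCQ g zs) : IsCompact (Slam φ g zs) := by
  obtain ⟨y, hy⟩ := hM
  have hclosed : IsClosed (Slam φ g zs) := by
    have : Slam φ g zs = {l : En m | gradient φ zs + ∑ i, l i • gradient (g i) zs = 0} ∩
        ({l : En m | ∀ i, g i zs ≤ 0} ∩ ((⋂ i, {l : En m | 0 ≤ l i}) ∩
          {l : En m | ∑ i, l i * g i zs = 0})) := by
      ext l
      simp [Slam, KKTat, gradL_eq l hφ hg]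
    rw [this]
    refine (isClosed_eq (by fun_prop) (by fun_prop)).inter (isClosed_const.inter
      ((isClosed_iInter fun i => isClosed_le (by fun_prop) (by fun_prop)).inter
        (isClosed_eq (by fun_prop) (by fun_prop))))
  have hK : IsCompact ((WithLp.toLp 2 : (Fin m → ℝ) → En m) '' Set.pi univ fun i =>
      Icc 0 (|⟪gradient φ zs, y⟫| / |⟪gradient (g i) zs, y⟫|)) :=
    (isCompact_univ_pi fun i => isCompact_Icc).image (PiLp.continuous_toLp 2 _)
  refine hK.of_isClosed_subset hclosed fun l hl => ⟨WithLp.ofLp l, fun i _ => ?_, rfl⟩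
  have hl' : KKTat φ g zs l := hl
  refine ⟨hl'.2.2.1 i, ?_⟩
  by_cases hi : g i zs = 0
  swap
  · rw [hl'.eq_zero_of_inactive hi]
    positivity
  have hsum : ⟪gradient φ zs, y⟫ + ∑ j, l j * ⟪gradient (g j) zs, y⟫ = 0 := by
    have := hl'.1
    rw [gradL_eq l hφ hg] at this
    have := congrArg (fun v => ⟪v, y⟫) this
    simpa [inner_add_left, sum_inner, real_inner_smul_left] using this
  have hterm : ∀ j, 0 ≤ -(l j * ⟪gradient (g j) zs, y⟫) := fun j => by
    by_cases hj : g j zs = 0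
    · nlinarith [hy j hj, hl'.2.2.1 j]
    · simp [hl'.eq_zero_of_inactive hj]
  have hle := Finset.single_le_sum (fun j _ => hterm j) (Finset.mem_univ i)
  rw [Finset.sum_neg_distrib] at hle
  rw [le_div_iff₀ (abs_pos.2 (hy i hi).ne), abs_of_neg (hy i hi)]
  linarith [le_abs_self ⟪gradient φ zs, y⟫]

theorem tendsto_smul_sub {F : Type*} [NormedAddCommGroup F] [NormedSpace ℝ F] {f : En n → F}
    (hf : DifferentiableAt ℝ f zs) {z : ℕ → En n} {δ : ℕ → ℝ} {w : En n}
    (hz : Tendsto z atTop (𝓝 zs)) (hw : Tendsto (fun k => (δ k)⁻¹ • (z k - zs)) atTop (𝓝 w)) :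
    Tendsto (fun k => (δ k)⁻¹ • (f (z k) - f zs)) atTop (𝓝 (fderiv ℝ f zs w)) := by
  have h0 : Tendsto (fun k => z k - zs) atTop (𝓝 0) := by
    simpa using hz.sub_const zs
  simpa using hf.hasFDerivAt.hasFDerivWithinAt.lim (s := univ) h0 (by simp) hw

theorem norm_gradL_le_eta (z : En n) (l : En m) : ‖gradL φ g l z‖ ≤ eta φ g z l :=
  Real.le_sqrt_of_sq_le (le_add_of_nonneg_right (Finset.sum_nonneg fun _ _ => sq_nonneg _))

theorem abs_min_le_eta (z : En n) (l : En m) (i : Fin m) :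
    |min (l i) (-(g i z))| ≤ eta φ g z l := by
  refine Real.le_sqrt_of_sq_le ?_
  rw [sq_abs]
  have := Finset.single_le_sum (f := fun i => (min (l i) (-(g i z))) ^ 2)
    (fun _ _ => sq_nonneg _) (Finset.mem_univ i)
  exact this.trans (le_add_of_nonneg_left (sq_nonneg _))

theorem eta_nonneg (z : En n) (l : En m) : 0 ≤ eta φ g z l := Real.sqrt_nonneg _

theorem deltaP_nonneg (z : En n) (l : En m) : 0 ≤ deltaP φ g zs z l := Real.sqrt_nonneg _

theorem norm_sub_le_deltaP (z : En n) (l : En m) : ‖z - zs‖ ≤ deltaP φ g zs z l :=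
  Real.le_sqrt_of_sq_le (le_add_of_nonneg_right (sq_nonneg _))

theorem infDist_le_deltaP (z : En n) (l : En m) :
    infDist l (Slam φ g zs) ≤ deltaP φ g zs z l :=
  Real.le_sqrt_of_sq_le (le_add_of_nonneg_left (sq_nonneg _))

section ComplementaritySequences

variable {a b p δ : ℕ → ℝ} {d p₀ : ℝ}

theorem tendsto_div_of_eventually_lt
    (hmin : Tendsto (fun k => min (a k) (b k) / δ k) atTop (𝓝 0))
    (hlt : ∀ᶠ k in atTop, min (a k) (b k) < b k) :
    Tendsto (fun k => a k / δ k) atTop (𝓝 0) := by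
  refine hmin.congr' (hlt.mono fun k hk => ?_)
  have : a k < b k := by simpa using hk
  simp only [min_eq_left this.le]

theorem tendsto_zero_of_tendsto_div (hδ : ∀ k, 0 < δ k) (hδ0 : Tendsto δ atTop (𝓝 0)) {c : ℝ}
    (h : Tendsto (fun k => a k / δ k) atTop (𝓝 c)) : Tendsto a atTop (𝓝 0) := by
  simpa [div_mul_cancel₀ _ (hδ _).ne'] using h.mul hδ0

theorem slope_eq_zero_of_inactive (hδ : ∀ k, 0 < δ k) (hδ0 : Tendsto δ atTop (𝓝 0))
    (hmin : Tendsto (fun k => min (a k) (b k) / δ k) atTop (𝓝 0))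
    (hd : Tendsto (fun k => (a k - p k) / δ k) atTop (𝓝 d)) (hp : ∀ k, p k = 0)
    {b₀ : ℝ} (hb : Tendsto b atTop (𝓝 b₀)) (hb₀ : 0 < b₀) : d = 0 := by
  have hlt := (tendsto_zero_of_tendsto_div hδ hδ0 hmin).eventually_lt hb hb₀
  simp only [hp, sub_zero] at hd
  exact tendsto_nhds_unique hd (tendsto_div_of_eventually_lt hmin hlt)

theorem slope_active (hδ : ∀ k, 0 < δ k) (hδ0 : Tendsto δ atTop (𝓝 0))
    (hmin : Tendsto (fun k => min (a k) (b k) / δ k) atTop (𝓝 0))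
    (hd : Tendsto (fun k => (a k - p k) / δ k) atTop (𝓝 d)) (hp : ∀ k, 0 ≤ p k)
    (hp₀ : Tendsto p atTop (𝓝 p₀)) {β : ℝ}
    (hb : Tendsto (fun k => b k / δ k) atTop (𝓝 β)) :
    0 ≤ β ∧ d * β ≤ 0 ∧ p₀ * β = 0 := by
  have hβ : 0 ≤ β := le_of_tendsto_of_tendsto' hmin hb fun k =>
    div_le_div_of_nonneg_right (min_le_right _ _) (hδ k).le
  rcases hβ.eq_or_lt with rfl | hpos
  · simp
  have ha := tendsto_div_of_eventually_lt hmin ((hmin.eventually_lt hb hpos).mono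
    fun k hk => (div_lt_div_iff_of_pos_right (hδ k)).1 hk)
  have hd0 : d ≤ 0 := le_of_tendsto_of_tendsto' hd ha fun k =>
    div_le_div_of_nonneg_right (sub_le_self _ (hp k)) (hδ k).le
  have hp0 : Tendsto p atTop (𝓝 0) := by
    simpa using (tendsto_zero_of_tendsto_div hδ hδ0 ha).sub
      (tendsto_zero_of_tendsto_div hδ hδ0 hd)
  refine ⟨hβ, mul_nonpos_of_nonpos_of_nonneg hd0 hβ, ?_⟩
  rw [tendsto_nhds_unique hp₀ hp0, zero_mul]

end ComplementaritySequences

/-- A sequence of primal-dual points approaching the solution set in the normalized limit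
direction `(w, d)`, with `p` the nearest multipliers, along which the KKT residual is
negligible with respect to the scale `δ`. -/
structure ResidualSeq (φ : En n → ℝ) (g : Fin m → En n → ℝ) (zs : En n)
    (z : ℕ → En n) (l p : ℕ → En m) (δ : ℕ → ℝ) (w : En n) (d p₀ : En m) : Prop where
  pos : ∀ k, 0 < δ k
  tendsto_scale : Tendsto δ atTop (𝓝 0)
  mem : ∀ k, p k ∈ Slam φ g zs
  nearest : ∀ k, ∀ q ∈ Slam φ g zs, ‖l k - p k‖ ≤ ‖l k - q‖
  tendsto_mult : Tendsto p atTop (𝓝 p₀)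
  mult_mem : p₀ ∈ Slam φ g zs
  tendsto_primal : Tendsto (fun k => (δ k)⁻¹ • (z k - zs)) atTop (𝓝 w)
  tendsto_dual : Tendsto (fun k => (δ k)⁻¹ • (l k - p k)) atTop (𝓝 d)
  residual : Tendsto (fun k => eta φ g (z k) (l k) / δ k) atTop (𝓝 0)

namespace ResidualSeq

variable {z : ℕ → En n} {l p : ℕ → En m} {δ : ℕ → ℝ} {w : En n} {d p₀ : En m}

theorem tendsto_point (h : ResidualSeq φ g zs z l p δ w d p₀) : Tendsto z atTop (𝓝 zs) := by
  have h1 : Tendsto (fun k => zs + δ k • ((δ k)⁻¹ • (z k - zs))) atTop (𝓝 (zs + (0 : ℝ) • w)) :=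
    (h.tendsto_scale.smul h.tendsto_primal).const_add zs
  simpa [smul_smul, mul_inv_cancel₀ (h.pos _).ne'] using h1

theorem tendsto_min (h : ResidualSeq φ g zs z l p δ w d p₀) (i : Fin m) :
    Tendsto (fun k => min (l k i) (-(g i (z k))) / δ k) atTop (𝓝 0) := by
  refine squeeze_zero_norm (fun k => ?_) h.residual
  rw [Real.norm_eq_abs, abs_div, abs_of_pos (h.pos k)]
  exact div_le_div_of_nonneg_right (abs_min_le_eta _ _ _) (h.pos k).le

theorem tendsto_dual_apply (h : ResidualSeq φ g zs z l p δ w d p₀) (i : Fin m) :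
    Tendsto (fun k => (l k i - p k i) / δ k) atTop (𝓝 (d i)) := by
  have := ((PiLp.continuous_apply 2 (fun _ : Fin m => ℝ) i).tendsto d).comp
    h.tendsto_dual
  refine this.congr fun k => ?_
  simp [div_eq_inv_mul]

theorem tendsto_mult_apply (h : ResidualSeq φ g zs z l p δ w d p₀) (i : Fin m) :
    Tendsto (fun k => p k i) atTop (𝓝 (p₀ i)) :=
  ((PiLp.continuous_apply 2 (fun _ : Fin m => ℝ) i).tendsto p₀).comp
    h.tendsto_mult

theorem dual_eq_zero_of_inactive (h : ResidualSeq φ g zs z l p δ w d p₀)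
    (hg : ∀ i, ContinuousAt (g i) zs) {i : Fin m} (hi : g i zs ≠ 0) : d i = 0 :=
  slope_eq_zero_of_inactive h.pos h.tendsto_scale (h.tendsto_min i) (h.tendsto_dual_apply i)
    (fun k => KKTat.eq_zero_of_inactive (h.mem k) hi)
    (((hg i).tendsto.comp h.tendsto_point).neg)
    (neg_pos.2 (lt_of_le_of_ne (h.mult_mem.2.1 i) hi))

theorem active (h : ResidualSeq φ g zs z l p δ w d p₀)
    (hg : ∀ i, DifferentiableAt ℝ (g i) zs) {i : Fin m} (hi : g i zs = 0) :
    ⟪gradient (g i) zs, w⟫ ≤ 0 ∧ 0 ≤ d i * ⟪gradient (g i) zs, w⟫ ∧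
      p₀ i * ⟪gradient (g i) zs, w⟫ = 0 := by
  have hb : Tendsto (fun k => -(g i (z k)) / δ k) atTop (𝓝 (-⟪gradient (g i) zs, w⟫)) := by
    have h1 := (tendsto_smul_sub (hg i) h.tendsto_point h.tendsto_primal).neg
    have h2 : fderiv ℝ (g i) zs w = ⟪gradient (g i) zs, w⟫ := by
      rw [(hg i).hasGradientAt.hasFDerivAt.fderiv, InnerProductSpace.toDual_apply_apply]
    rw [h2] at h1
    refine h1.congr fun k => ?_
    simp [hi, div_eq_inv_mul]
  obtain ⟨h1, h2, h3⟩ := slope_active h.pos h.tendsto_scale (h.tendsto_min i)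
    (h.tendsto_dual_apply i) (fun k => (h.mem k).2.2.1 i) (h.tendsto_mult_apply i) hb
  exact ⟨by linarith, by linarith, by linarith⟩

/-- The linearized stationarity condition satisfied by the limit direction. -/
theorem stationary (h : ResidualSeq φ g zs z l p δ w d p₀) (hφ : ContDiffAt ℝ 2 φ zs)
    (hg : ∀ i, ContDiffAt ℝ 2 (g i) zs) :
    hessL φ g p₀ zs w + ∑ i, d i • gradient (g i) zs = 0 := by
  have hz := h.tendsto_point
  have hgrad : Tendsto (fun k => (δ k)⁻¹ • gradL φ g (l k) (z k)) atTop (𝓝 0) := by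
    refine squeeze_zero_norm (fun k => ?_) h.residual
    rw [norm_smul, norm_inv, Real.norm_eq_abs, abs_of_pos (h.pos k), div_eq_inv_mul]
    exact mul_le_mul_of_nonneg_left (norm_gradL_le_eta _ _) (inv_nonneg.2 (h.pos k).le)
  have hlim := ((tendsto_smul_sub hφ.differentiableAt_gradient hz h.tendsto_primal).add
    (tendsto_finsetSum Finset.univ fun i _ => (h.tendsto_mult_apply i).smul
      (tendsto_smul_sub (hg i).differentiableAt_gradient hz h.tendsto_primal))).add
    (tendsto_finsetSum Finset.univ fun i _ => (h.tendsto_dual_apply i).smul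
      ((hg i).differentiableAt_gradient.continuousAt.tendsto.comp hz))
  rw [hessL_apply hφ hg]
  refine tendsto_nhds_unique (hlim.congr' ?_) hgrad
  filter_upwards [hz.eventually (eventually_gradL_eq hφ hg)] with k hk
  have h0 : gradient φ zs + ∑ i, p k i • gradient (g i) zs = 0 := by
    rw [← (eventually_gradL_eq hφ hg).self_of_nhds]
    exact (h.mem k).1
  rw [hk, ← sub_zero (gradient φ (z k) + _), ← h0]
  simp only [smul_sub, smul_add, Finset.smul_sum, div_eq_inv_mul, smul_smul, sub_smul, sub_mul,
    Finset.sum_sub_distrib, Function.comp_apply, mul_comm (δ k)⁻¹]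
  abel

theorem primal_eq_zero (h : ResidualSeq φ g zs z l p δ w d p₀) (hφ : ContDiffAt ℝ 2 φ zs)
    (hg : ∀ i, ContDiffAt ℝ 2 (g i) zs) (hS : SOC φ g zs) : w = 0 := by
  obtain ⟨σ, hσ, hS⟩ := hS
  have hφ' := hφ.differentiableAt (by norm_num)
  have hg' := fun i => (hg i).differentiableAt (n := 2) (by norm_num)
  have hinner : ∀ q ∈ Slam φ g zs,
      ⟪gradient φ zs, w⟫ + ∑ j, q j * ⟪gradient (g j) zs, w⟫ = 0 := fun q hq => by
    have := hq.1
    rw [gradL_eq q hφ' hg'] at this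
    have := congrArg (fun v => ⟪v, w⟫) this
    simpa [inner_add_left, sum_inner, real_inner_smul_left] using this
  have hp₀ : ∑ j, p₀ j * ⟪gradient (g j) zs, w⟫ = 0 := by
    refine Finset.sum_eq_zero fun j _ => ?_
    by_cases hj : g j zs = 0
    · exact (h.active hg' hj).2.2
    · rw [KKTat.eq_zero_of_inactive h.mult_mem hj, zero_mul]
  have hφw : ⟪gradient φ zs, w⟫ = 0 := by linarith [hinner p₀ h.mult_mem]
  have hplus : ∀ i ∈ Bplus φ g zs, ⟪gradient (g i) zs, w⟫ = 0 := by
    rintro i ⟨hi, q, hq, hqi⟩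
    have hsum : ∑ j, q j * ⟪gradient (g j) zs, w⟫ = 0 := by linarith [hinner q hq]
    have := (Finset.sum_eq_zero_iff_of_nonpos fun j _ => ?_).1 hsum i (Finset.mem_univ i)
    · exact (mul_eq_zero.1 this).resolve_left hqi.ne'
    · by_cases hj : g j zs = 0
      · exact mul_nonpos_of_nonneg_of_nonpos (hq.2.2.1 j) (h.active hg' hj).1
      · rw [KKTat.eq_zero_of_inactive hq hj, zero_mul]
  have hcurv := hS p₀ h.mult_mem w hplus fun i hi => (h.active hg' hi.1).1
  have hst := congrArg (fun v => ⟪w, v⟫) (h.stationary hφ hg)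
  simp only [inner_add_right, inner_sum, real_inner_smul_right, inner_zero_right] at hst
  have hd : 0 ≤ ∑ i, d i * ⟪w, gradient (g i) zs⟫ := Finset.sum_nonneg fun i _ => by
    by_cases hi : g i zs = 0
    · rw [real_inner_comm]
      exact (h.active hg' hi).2.1
    · rw [h.dual_eq_zero_of_inactive (fun i => (hg i).continuousAt) hi, zero_mul]
  have : ‖w‖ ^ 2 ≤ 0 := by nlinarith
  simpa using this

theorem dual_eq_zero (h : ResidualSeq φ g zs z l p δ w d p₀) (hφ : ContDiffAt ℝ 2 φ zs)
    (hg : ∀ i, ContDiffAt ℝ 2 (g i) zs) (hw : w = 0) : d = 0 := by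
  have hsum : ∑ i, d i • gradient (g i) zs = 0 := by
    simpa [hw] using h.stationary hφ hg
  by_contra hd
  have hsign : ∀ᶠ k in atTop, ∀ i, 0 ≤ d i ∨ 0 < p k i := by
    refine eventually_all.2 fun i => ?_
    rcases le_or_gt 0 (d i) with hi | hi
    · exact Eventually.of_forall fun _ => Or.inl hi
    filter_upwards [(h.tendsto_dual_apply i).eventually_lt (h.tendsto_min i) hi] with k hk
    refine Or.inr ((h.mem k).2.2.1 i |>.lt_of_ne fun h0 => ?_)
    rw [← h0, sub_zero, div_lt_div_iff_of_pos_right (h.pos k)] at hk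
    exact absurd (min_le_left _ _) (not_le.2 hk)
  have hin : ∀ᶠ k in atTop, 0 < ⟪(δ k)⁻¹ • (l k - p k), d⟫ := by
    have : Tendsto (fun k => ⟪(δ k)⁻¹ • (l k - p k), d⟫) atTop (𝓝 ⟪d, d⟫) :=
      h.tendsto_dual.inner tendsto_const_nhds
    exact this.eventually_const_lt (real_inner_self_pos.2 hd)
  obtain ⟨k, hk, hkin⟩ := (hsign.and hin).exists
  rw [real_inner_smul_left] at hkin
  have hc : 0 < ⟪l k - p k, d⟫ := (pos_iff_pos_of_mul_pos hkin).1 (inv_pos.2 (h.pos k))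
  have hfeas : ∀ᶠ ε : ℝ in 𝓝[>] 0, p k + ε • d ∈ Slam φ g zs := by
    have hnn : ∀ᶠ ε : ℝ in 𝓝[>] 0, ∀ i, 0 ≤ p k i + ε * d i := by
      refine eventually_all.2 fun i => ?_
      rcases hk i with hi | hi
      · filter_upwards [self_mem_nhdsWithin] with ε hε
        exact add_nonneg ((h.mem k).2.2.1 i) (mul_nonneg (le_of_lt hε) hi)
      · have : Tendsto (fun ε : ℝ => p k i + ε * d i) (𝓝[>] 0) (𝓝 (p k i + 0 * d i)) :=
          (Continuous.tendsto (by fun_prop) 0).mono_left nhdsWithin_le_nhds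
        rw [zero_mul, add_zero] at this
        exact (this.eventually_const_lt hi).mono fun _ h => h.le
    filter_upwards [hnn] with ε hε
    have h0 := (h.mem k).1
    rw [(eventually_gradL_eq hφ hg).self_of_nhds] at h0
    refine ⟨?_, (h.mem k).2.1, fun i => by simpa using hε i, Finset.sum_eq_zero fun i _ => ?_⟩
    · rw [(eventually_gradL_eq hφ hg).self_of_nhds]
      simp only [PiLp.add_apply, PiLp.smul_apply, smul_eq_mul, add_smul, mul_smul,
        Finset.sum_add_distrib, ← Finset.smul_sum, hsum, smul_zero, add_zero]
      exact h0
    · by_cases hi : g i zs = 0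
      · rw [hi, mul_zero]
      · simp [h.dual_eq_zero_of_inactive (fun i => (hg i).continuousAt) hi,
          KKTat.eq_zero_of_inactive (h.mem k) hi]
  have hsmall : ∀ᶠ ε : ℝ in 𝓝[>] 0, ε * ‖d‖ ^ 2 < 2 * ⟪l k - p k, d⟫ := by
    have : Tendsto (fun ε : ℝ => ε * ‖d‖ ^ 2) (𝓝[>] 0) (𝓝 (0 * ‖d‖ ^ 2)) :=
      (Continuous.tendsto (by fun_prop) 0).mono_left nhdsWithin_le_nhds
    rw [zero_mul] at this
    exact this.eventually_lt_const (by linarith)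
  obtain ⟨ε, ⟨hε1, hε2⟩, hε3⟩ :=
    ((hfeas.and hsmall).and (self_mem_nhdsWithin : Ioi (0 : ℝ) ∈ 𝓝[>] 0)).exists
  have hnear := h.nearest k _ hε1
  rw [← sub_sub] at hnear
  have hsq := pow_le_pow_left₀ (norm_nonneg _) hnear 2
  rw [norm_sub_sq_real (l k - p k), real_inner_smul_right, norm_smul, mul_pow,
    Real.norm_eq_abs, sq_abs] at hsq
  have hε0 : 0 < ε := hε3
  nlinarith

end ResidualSeq

/-- The filter of primal-dual pairs whose distance to the solution set tends to zero. -/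
def nearSol (φ : En n → ℝ) (g : Fin m → En n → ℝ) (zs : En n) : Filter (En n × En m) :=
  comap (fun q => deltaP φ g zs q.1 q.2) (𝓝 0)

theorem eventually_nearSol_iff {P : En n × En m → Prop} :
    (∀ᶠ q in nearSol φ g zs, P q) ↔
      ∃ δ₂ > 0, ∀ q : En n × En m, deltaP φ g zs q.1 q.2 ≤ δ₂ → P q := by
  have hb := (Metric.nhds_basis_closedBall (x := (0 : ℝ))).comap
    fun q : En n × En m => deltaP φ g zs q.1 q.2
  rw [nearSol, hb.eventually_iff]
  simp [abs_of_nonneg (deltaP_nonneg _ _)]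

theorem tendsto_deltaP : Tendsto (fun q => deltaP φ g zs q.1 q.2) (nearSol φ g zs) (𝓝 0) :=
  tendsto_comap

theorem tendsto_fst_nearSol : Tendsto Prod.fst (nearSol φ g zs) (𝓝 zs) := by
  rw [tendsto_iff_norm_sub_tendsto_zero]
  exact squeeze_zero (fun _ => norm_nonneg _) (fun q => norm_sub_le_deltaP q.1 q.2) tendsto_deltaP

theorem eventually_nearSol_of_forall_mem (hS : IsCompact (Slam φ g zs))
    (hne : (Slam φ g zs).Nonempty) {P : En n × En m → Prop}
    (h : ∀ q ∈ Slam φ g zs, ∀ᶠ x in 𝓝 (zs, q), P x) : ∀ᶠ x in nearSol φ g zs, P x := by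
  have hsub : ({zs} : Set (En n)) ×ˢ Slam φ g zs ⊆ {x | ∀ᶠ y in 𝓝 x, P y} := by
    rintro ⟨a, q⟩ ⟨rfl, hq⟩
    exact h q hq
  obtain ⟨δ, hδ, hsub⟩ := (isCompact_singleton.prod hS).exists_thickening_subset_open
    isOpen_setOfPred_eventually_nhds hsub
  refine eventually_nearSol_iff.2 ⟨δ / 2, half_pos hδ, fun x hx => ?_⟩
  obtain ⟨q, hq, hqd⟩ := hS.exists_infDist_eq_dist hne x.2
  have hmem : x ∈ thickening δ (({zs} : Set (En n)) ×ˢ Slam φ g zs) := by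
    refine mem_thickening_iff.2 ⟨(zs, q), ⟨rfl, hq⟩, ?_⟩
    rw [Prod.dist_eq, max_lt_iff, dist_eq_norm, ← hqd]
    constructor
    · linarith [norm_sub_le_deltaP (φ := φ) (g := g) (zs := zs) x.1 x.2]
    · linarith [infDist_le_deltaP (φ := φ) (g := g) (zs := zs) x.1 x.2]
  exact (hsub hmem).self_of_nhds

theorem KKTat.eta_eq_zero {z : En n} {l : En m} (h : KKTat φ g z l) : eta φ g z l = 0 := by
  have : ∀ i, min (l i) (-(g i z)) = 0 := fun i => by
    rcases mul_eq_zero.1 (h.mul_constraint_eq_zero i) with h0 | h0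
    · simp [h0, h.2.1 i]
    · simp [h0, h.2.2.1 i]
  simp [eta, h.1, this]

theorem tendsto_eta_nearSol (hφ : ContDiffAt ℝ 2 φ zs) (hg : ∀ i, ContDiffAt ℝ 2 (g i) zs)
    (hS : IsCompact (Slam φ g zs)) (hne : (Slam φ g zs).Nonempty) :
    Tendsto (fun q => eta φ g q.1 q.2) (nearSol φ g zs) (𝓝 0) := by
  refine tendsto_order.2 ⟨fun a ha => Eventually.of_forall fun q => ha.trans_le (eta_nonneg _ _),
    fun a ha => eventually_nearSol_of_forall_mem hS hne fun q hq => ?_⟩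
  have hfst : Tendsto (fun x : En n × En m => x.1) (𝓝 (zs, q)) (𝓝 zs) :=
    continuous_fst.tendsto (zs, q)
  have happ : ∀ i, Tendsto (fun x : En n × En m => x.2 i) (𝓝 (zs, q)) (𝓝 (q i)) := fun i =>
    Continuous.tendsto (f := fun x : En n × En m => x.2 i) (by fun_prop) (zs, q)
  have hgrad : Tendsto (fun x : En n × En m => gradL φ g x.2 x.1) (𝓝 (zs, q))
      (𝓝 (gradL φ g q zs)) := by
    have h1 := (hφ.differentiableAt_gradient.continuousAt.tendsto.comp hfst).add
      (tendsto_finsetSum Finset.univ fun i _ => (happ i).smul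
        ((hg i).differentiableAt_gradient.continuousAt.tendsto.comp hfst))
    rw [(eventually_gradL_eq hφ hg).self_of_nhds]
    refine h1.congr' ?_
    filter_upwards [hfst.eventually (eventually_gradL_eq hφ hg)] with x hx
    simp [hx]
  have heta : Tendsto (fun x : En n × En m => eta φ g x.1 x.2) (𝓝 (zs, q))
      (𝓝 (eta φ g zs q)) :=
    ((hgrad.norm.pow 2).add (tendsto_finsetSum Finset.univ fun i _ =>
      ((happ i).min ((hg i).continuousAt.tendsto.comp hfst).neg).pow 2)).sqrt
  rw [KKTat.eta_eq_zero hq] at heta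
  exact heta.eventually_lt_const ha

/-- The local error bound: near the solution set the KKT residual controls the distance to it. -/
theorem exists_deltaP_le_mul_eta (hφ : ContDiffAt ℝ 2 φ zs) (hg : ∀ i, ContDiffAt ℝ 2 (g i) zs)
    (hS : IsCompact (Slam φ g zs)) (hne : (Slam φ g zs).Nonempty) (hsoc : SOC φ g zs) :
    ∃ C > 0, ∀ᶠ q in nearSol φ g zs, deltaP φ g zs q.1 q.2 ≤ C * eta φ g q.1 q.2 := by
  by_contra! hcon
  have hex : ∀ k : ℕ, ∃ q : En n × En m, deltaP φ g zs q.1 q.2 ≤ 1 / ((k : ℝ) + 1) ∧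
      ((k : ℝ) + 1) * eta φ g q.1 q.2 < deltaP φ g zs q.1 q.2 := fun k => by
    have hk : (0 : ℝ) < (k : ℝ) + 1 := by positivity
    obtain ⟨q, h1, h2⟩ := ((hcon _ hk).and_eventually
      (tendsto_deltaP.eventually_le_const (one_div_pos.2 hk))).exists
    exact ⟨q, h2, h1⟩
  choose q hq1 hq2 using hex
  choose p hp hpd using fun k => hS.exists_infDist_eq_dist hne (q k).2
  set δ : ℕ → ℝ := fun k => deltaP φ g zs (q k).1 (q k).2 with hδ
  have hδpos : ∀ k, 0 < δ k := fun k =>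
    (mul_nonneg (by positivity) (eta_nonneg _ _)).trans_lt (hq2 k)
  have hδ0 : Tendsto δ atTop (𝓝 0) :=
    squeeze_zero (fun k => (hδpos k).le) hq1 tendsto_one_div_add_atTop_nhds_zero_nat
  have hres : Tendsto (fun k => eta φ g (q k).1 (q k).2 / δ k) atTop (𝓝 0) := by
    refine squeeze_zero (fun k => div_nonneg (eta_nonneg _ _) (hδpos k).le) (fun k => ?_)
      tendsto_one_div_add_atTop_nhds_zero_nat
    rw [div_le_div_iff₀ (hδpos k) (by positivity), one_mul, mul_comm]
    exact (hq2 k).le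
  have hsq : ∀ k, ‖(δ k)⁻¹ • ((q k).1 - zs)‖ ^ 2 + ‖(δ k)⁻¹ • ((q k).2 - p k)‖ ^ 2 = 1 :=
    fun k => by
      have h1 : δ k ^ 2 = ‖(q k).1 - zs‖ ^ 2 + ‖(q k).2 - p k‖ ^ 2 := by
        rw [hδ]
        simp only [deltaP]
        rw [Real.sq_sqrt (by positivity), hpd k, dist_eq_norm]
      rw [norm_smul, norm_smul, mul_pow, mul_pow, ← mul_add, ← h1, norm_inv, Real.norm_eq_abs,
        inv_pow, sq_abs, inv_mul_cancel₀ (pow_pos (hδpos k) 2).ne']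
  have hcomp := ((isCompact_closedBall (0 : En n) 1).prod (isCompact_closedBall (0 : En m) 1)).prod
    hS
  obtain ⟨⟨⟨w, d⟩, p₀⟩, hmem, ψ, hψ, hlim⟩ := hcomp.tendsto_subseq
    (x := fun k => (((δ k)⁻¹ • ((q k).1 - zs), (δ k)⁻¹ • ((q k).2 - p k)), p k)) fun k => by
      refine ⟨⟨?_, ?_⟩, hp k⟩ <;> rw [mem_closedBall_zero_iff] <;>
        refine (sq_le_one_iff₀ (norm_nonneg _)).1 ?_
      · linarith [hsq k, sq_nonneg ‖(δ k)⁻¹ • ((q k).2 - p k)‖]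
      · linarith [hsq k, sq_nonneg ‖(δ k)⁻¹ • ((q k).1 - zs)‖]
  rw [Prod.tendsto_iff, Prod.tendsto_iff] at hlim
  obtain ⟨⟨hlw, hld⟩, hlp⟩ := hlim
  have hseq : ResidualSeq φ g zs (fun k => (q (ψ k)).1) (fun k => (q (ψ k)).2)
      (fun k => p (ψ k)) (fun k => δ (ψ k)) w d p₀ :=
    { pos := fun k => hδpos _
      tendsto_scale := hδ0.comp hψ.tendsto_atTop
      mem := fun k => hp _
      nearest := fun k r hr => by
        rw [← dist_eq_norm, ← dist_eq_norm, ← hpd]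
        exact infDist_le_dist_of_mem hr
      tendsto_mult := hlp
      mult_mem := hmem.2
      tendsto_primal := hlw
      tendsto_dual := hld
      residual := hres.comp hψ.tendsto_atTop }
  have hw := hseq.primal_eq_zero hφ hg hsoc
  have hd := hseq.dual_eq_zero hφ hg hw
  have hone : ‖w‖ ^ 2 + ‖d‖ ^ 2 = 1 :=
    tendsto_nhds_unique ((hlw.norm.pow 2).add (hld.norm.pow 2))
      (tendsto_const_nhds.congr fun k => (hsq (ψ k)).symm)
  simp [hw, hd] at hone

theorem tendsto_eta_rpow (h : Tendsto (fun q => eta φ g q.1 q.2) (nearSol φ g zs) (𝓝 0))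
    {s : ℝ} (hs : 0 < s) : Tendsto (fun q => eta φ g q.1 q.2 ^ s) (nearSol φ g zs) (𝓝 0) := by
  simpa [Real.zero_rpow hs.ne'] using h.rpow_const (Or.inr hs.le)

/-- A function that is Lipschitz at `zs` deviates from its value there by at most `η ^ τ`. -/
theorem eventually_norm_sub_le_eta_rpow {F : Type*} [NormedAddCommGroup F] [NormedSpace ℝ F]
    {f : En n → F} (hf : DifferentiableAt ℝ f zs)
    (heta : Tendsto (fun q => eta φ g q.1 q.2) (nearSol φ g zs) (𝓝 0))
    (hbound : ∃ C > 0, ∀ᶠ q in nearSol φ g zs, deltaP φ g zs q.1 q.2 ≤ C * eta φ g q.1 q.2)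
    {τ : ℝ} (h0 : 0 < τ) (h1 : τ < 1) :
    ∀ᶠ q in nearSol φ g zs, ‖f q.1 - f zs‖ ≤ eta φ g q.1 q.2 ^ τ := by
  obtain ⟨C, hC, hbound⟩ := hbound
  obtain ⟨K, hK, hlip⟩ := hf.hasFDerivAt.isBigO_sub.exists_pos
  have hsmall : ∀ᶠ q in nearSol φ g zs, K * C * eta φ g q.1 q.2 ^ (1 - τ) ≤ 1 := by
    have := (tendsto_eta_rpow heta (sub_pos.2 h1)).const_mul (K * C)
    rw [mul_zero] at this
    exact this.eventually_le_const one_pos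
  filter_upwards [tendsto_fst_nearSol.eventually hlip.bound, hbound, hsmall] with q hq hqC hqs
  have hη := eta_nonneg (φ := φ) (g := g) q.1 q.2
  calc ‖f q.1 - f zs‖ ≤ K * ‖q.1 - zs‖ := hq
    _ ≤ K * (C * eta φ g q.1 q.2) :=
      mul_le_mul_of_nonneg_left ((norm_sub_le_deltaP _ _).trans hqC) hK.le
    _ = (K * C * eta φ g q.1 q.2 ^ (1 - τ)) * eta φ g q.1 q.2 ^ τ := by
      rw [mul_assoc (K * C), ← Real.rpow_add_of_nonneg hη (by linarith) h0.le, sub_add_cancel,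
        Real.rpow_one, mul_assoc]
    _ ≤ 1 * eta φ g q.1 q.2 ^ τ := mul_le_mul_of_nonneg_right hqs (Real.rpow_nonneg hη _)
    _ = _ := one_mul _

theorem LPFeasible.nonneg {τ : ℝ} {z : En n} {l lt : En m} (h : LPFeasible φ g τ z l lt)
    (i : Fin m) : 0 ≤ lt i := by
  by_cases hi : i ∈ Aest φ g τ z l
  · exact h.2.1 i hi
  · exact (h.2.2 i hi).ge

theorem LPOptimal.exists_le {τ : ℝ} {z : En n} {l lt q : En m} {Ah : Set (Fin m)}
    (h : LPOptimal φ g τ z l Ah lt) (hq : LPFeasible φ g τ z l q) {i : Fin m} (hi : i ∈ Ah)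
    {c : ℝ} (hc : m * c < q i) : ∃ j ∈ Ah, c ≤ lt j := by
  by_contra! hlt
  have hnn : ∀ j, 0 ≤ Ah.indicator (fun j => q j) j :=
    fun j => indicator_nonneg (fun j _ => hq.nonneg j) j
  have h1 : q i ≤ lpObj Ah q := by
    have := Finset.single_le_sum (fun j _ => hnn j) (Finset.mem_univ i)
    rwa [indicator_of_mem hi] at this
  have hc0 : 0 ≤ c := (h.1.nonneg i).trans (hlt i hi).le
  have h2 : lpObj Ah lt ≤ m * c := by
    have : ∀ j ∈ Finset.univ, Ah.indicator (fun j => lt j) j ≤ c := fun j _ =>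
      indicator_apply_le' (fun hj => (hlt j hj).le) fun _ => hc0
    simpa [lpObj] using Finset.sum_le_card_nsmul _ _ _ this
  linarith [h.2 q hq]

theorem Bplus_subset_of_ID0Out {τ th : ℝ} {z : En n} {l : En m} {A0 Ap : Set (Fin m)}
    (hout : ID0Out φ g τ th z l A0 Ap) (hA : Bplus φ g zs ⊆ Aest φ g τ z l)
    (hex : ∀ i ∈ Bplus φ g zs, ∃ q, LPFeasible φ g τ z l q ∧ m * eta φ g z l ^ th < q i) :
    Bplus φ g zs ⊆ Ap := by
  obtain ⟨Ah, -, ⟨lt, hopt, hC, -, rfl⟩ | ⟨-, -, -, -, -, rfl⟩⟩ := hout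
  · refine fun i hi => ⟨hA hi, fun hiAh => ?_⟩
    obtain ⟨q, hq, hlt⟩ := hex i hi
    obtain ⟨j, hj, hle⟩ := hopt.exists_le hq hiAh hlt
    exact eq_empty_iff_forall_notMem.1 hC j ⟨hj, hle⟩
  · exact hA

theorem eventually_LPFeasible {τ : ℝ} (hφ : ContDiffAt ℝ 2 φ zs)
    (hg : ∀ i, ContDiffAt ℝ 2 (g i) zs)
    (hsmall : ∀ f : En n → En n, DifferentiableAt ℝ f zs →
      ∀ᶠ q in nearSol φ g zs, ‖f q.1 - f zs‖ ≤ eta φ g q.1 q.2 ^ τ)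
    (hA : ∀ᶠ q in nearSol φ g zs, Bplus φ g zs ⊆ Aest φ g τ q.1 q.2)
    {r : En m} (hr : r ∈ Slam φ g zs) :
    ∀ᶠ q in nearSol φ g zs, LPFeasible φ g τ q.1 q.2 r := by
  have hdiff : DifferentiableAt ℝ (fun z => gradient φ z + ∑ i, r i • gradient (g i) z) zs :=
    hφ.differentiableAt_gradient.add (DifferentiableAt.fun_sum fun i _ =>
      (hg i).differentiableAt_gradient.const_smul (r i))
  have h0 : gradient φ zs + ∑ i, r i • gradient (g i) zs = 0 := by
    rw [← (eventually_gradL_eq hφ hg).self_of_nhds]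
    exact hr.1
  filter_upwards [hsmall _ hdiff, hA] with q hq hqA
  rw [h0, sub_zero] at hq
  refine ⟨fun j => (PiLp.norm_apply_le _ j).trans hq, fun i _ => hr.2.2.1 i, fun i hi => ?_⟩
  by_contra hne
  have hpos := (hr.2.2.1 i).lt_of_ne' hne
  exact hi (hqA ⟨(mul_eq_zero.1 (KKTat.mul_constraint_eq_zero hr i)).resolve_left hne, r, hr, hpos⟩)

end

/-- Lemma 3.3: for (z,λ) close enough to S, every possible output of Procedure ID0
satisfies B₊ ⊆ A₊. -/
theorem stmt_5 {n m : ℕ} (φ : En n → ℝ) (g : Fin m → En n → ℝ) (zs : En n)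
    (hA : AssumpA φ g zs) (τ th : ℝ) (h0 : 0 < th) (h1 : th < τ) (h2 : τ < 1) :
    ∃ δ₂ : ℝ, 0 < δ₂ ∧
      ∀ (z : En n) (l : En m), deltaP φ g zs z l ≤ δ₂ →
        ∀ A0 Ap : Set (Fin m), ID0Out φ g τ th z l A0 Ap →
          Bplus φ g zs ⊆ Ap := by
  obtain ⟨hsm, hne, hM, hsoc⟩ := hA
  obtain ⟨hφ, hg⟩ := hsm.contDiffAt
  have hS := isCompact_Slam (hφ.differentiableAt (by norm_num))
    (fun i => (hg i).differentiableAt (by norm_num)) hM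
  have heta := tendsto_eta_nearSol hφ hg hS hne
  have hbound := exists_deltaP_le_mul_eta hφ hg hS hne hsoc
  have hAest : ∀ᶠ q in nearSol φ g zs, Bplus φ g zs ⊆ Aest φ g τ q.1 q.2 := by
    filter_upwards [eventually_all.2 fun i => eventually_norm_sub_le_eta_rpow
      ((hg i).differentiableAt (by norm_num)) heta hbound (h0.trans h1) h2] with q hq i hi
    have := hq i
    rw [hi.1, sub_zero] at this
    exact (abs_le.1 this).1
  have hfeas : ∀ r ∈ Slam φ g zs, ∀ᶠ q in nearSol φ g zs, LPFeasible φ g τ q.1 q.2 r :=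
    fun r hr => eventually_LPFeasible hφ hg
      (fun f hf => eventually_norm_sub_le_eta_rpow hf heta hbound (h0.trans h1) h2) hAest hr
  have hex : ∀ᶠ q in nearSol φ g zs, ∀ i ∈ Bplus φ g zs,
      ∃ r, LPFeasible φ g τ q.1 q.2 r ∧ m * eta φ g q.1 q.2 ^ th < r i := by
    refine eventually_all.2 fun i => eventually_imp_distrib_left.2 ?_
    rintro ⟨-, r, hr, hri⟩
    have := (tendsto_eta_rpow heta h0).const_mul (m : ℝ)
    rw [mul_zero] at this
    filter_upwards [hfeas r hr, this.eventually_lt_const hri] with q hq hlt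
    exact ⟨r, hq, hlt⟩
  obtain ⟨δ₂, hδ₂, h⟩ := eventually_nearSol_iff.1 (hAest.and hex)
  exact ⟨δ₂, hδ₂, fun z l hzl A0 Ap hout =>
    Bplus_subset_of_ID0Out hout (h (z, l) hzl).1 (h (z, l) hzl).2⟩
end
end

section
/- Let z ∈ ℝⁿ, let A₊ ⊆ {1,…,m}, and suppose there exist ȳ ∈ ℝⁿ and ζ > 0 such that ȳᵀ∇g_i(z) ≤ −ζ for all i ∈ A₊. Then any (t̂, λ̂) feasible for the linear program (intlam) satisfies ‖λ̂_{A₊}‖₁ ≤ ζ⁻¹ ‖ȳ‖₁ (‖∇φ(z)‖_∞ + η(z,λ)^τ); in particular, the feasible region of (intlam) has bounded λ̂-component. -/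
open scoped RealInnerProductSpace
open Metric Set

noncomputable section

/-- Hölder's inequality for the pairing of the ℓ∞ and ℓ¹ norms. -/
lemma abs_inner_le_mul_sum_abs {n : ℕ} {v y : En n} {c : ℝ} (hv : ∀ j, |v j| ≤ c) :
    |⟪v, y⟫| ≤ c * ∑ j, |y j| := by
  rw [PiLp.inner_apply, Finset.mul_sum]
  refine (Finset.abs_sum_le_sum_abs _ _).trans (Finset.sum_le_sum fun j _ => ?_)
  rw [Real.inner_apply, abs_mul]
  exact mul_le_mul_of_nonneg_right (hv j) (abs_nonneg _)

/-- The Euclidean norm is at most the ℓ¹ norm. -/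
lemma norm_le_sum_abs {m : ℕ} (x : En m) : ‖x‖ ≤ ∑ i, |x i| := by
  rw [EuclideanSpace.norm_eq]
  refine Real.sqrt_le_iff.2 ⟨Finset.sum_nonneg fun i _ => abs_nonneg _, ?_⟩
  exact Finset.sum_sq_le_sq_sum_of_nonneg fun i _ => abs_nonneg _

/-- For a vector that is feasible for (intlam), the ℓ¹ norm of the subvector indexed by `Ap`
is the full ℓ¹ norm. -/
lemma IntFeasible.sum_indicator_abs {n m : ℕ} {φ : En n → ℝ} {g : Fin m → En n → ℝ} {τ : ℝ}
    {z : En n} {l : En m} {Ap : Set (Fin m)} {t : ℝ} {lh : En m}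
    (h : IntFeasible φ g τ z l Ap t lh) :
    ∑ i, Ap.indicator (fun i => |lh i|) i = ∑ i, |lh i| := by
  refine Finset.sum_congr rfl fun i _ => ?_
  by_cases hi : i ∈ Ap
  · exact Set.indicator_of_mem hi _
  · rw [Set.indicator_of_notMem hi, h.2.2.2 i hi, abs_zero]

/-- The ℓ¹ bound on vectors feasible for (intlam). -/
lemma IntFeasible.sum_abs_le {n m : ℕ} {φ : En n → ℝ} {g : Fin m → En n → ℝ} {τ : ℝ}
    {z : En n} {l : En m} {Ap : Set (Fin m)} {t : ℝ} {lh : En m}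
    (h : IntFeasible φ g τ z l Ap t lh) {ybar : En n} {ζ : ℝ} (hζ : 0 < ζ)
    (hy : ∀ i ∈ Ap, ⟪gradient (g i) z, ybar⟫ ≤ -ζ) :
    ∑ i, |lh i| ≤
      ζ⁻¹ * (∑ j, |ybar j|) *
        ((⨆ j : Fin n, |(gradient φ z) j|) + (eta φ g z l) ^ τ) := by
  obtain ⟨-, hgrad, hpos, hzero⟩ := h
  have hφ_bound : |⟪gradient φ z, ybar⟫| ≤ (⨆ j, |gradient φ z j|) * ∑ j, |ybar j| :=
    abs_inner_le_mul_sum_abs fun j => le_ciSup (f := fun j => |gradient φ z j|)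
      (Set.finite_range _).bddAbove j
  have hsum_bound := abs_inner_le_mul_sum_abs (y := ybar) hgrad
  rw [inner_add_left, sum_inner] at hsum_bound
  have hdescent : ∑ i, ⟪lh i • gradient (g i) z, ybar⟫ ≤ -(ζ * ∑ i, |lh i|) := by
    rw [Finset.mul_sum, ← Finset.sum_neg_distrib]
    refine Finset.sum_le_sum fun i _ => ?_
    rw [real_inner_smul_left]
    by_cases hi : i ∈ Ap
    · rw [abs_of_nonneg (hpos i hi)]
      nlinarith [mul_le_mul_of_nonneg_left (hy i hi) (hpos i hi)]
    · simp [hzero i hi]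
  rw [mul_assoc, le_inv_mul_iff₀ hζ]
  linarith [(abs_le.1 hφ_bound).2, (abs_le.1 hsum_bound).1]

/-- If ȳᵀ∇g_i(z) ≤ −ζ for all i ∈ A₊, then every (t̂, λ̂) feasible for (intlam) satisfies
‖λ̂_{A₊}‖₁ ≤ ζ⁻¹‖ȳ‖₁(‖∇φ(z)‖_∞ + η(z,λ)^τ); in particular the feasible region of (intlam)
has bounded λ̂-component. -/
theorem stmt_15 {n m : ℕ} (φ : En n → ℝ) (g : Fin m → En n → ℝ)
    (hφ : ContDiff ℝ 1 φ) (hg : ∀ i, ContDiff ℝ 1 (g i))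
    (z : En n) (l : En m) (τ : ℝ) (hτ0 : 0 < τ) (hτ1 : τ < 1)
    (Ap : Set (Fin m)) (ybar : En n) (ζ : ℝ) (hζ : 0 < ζ)
    (hy : ∀ i ∈ Ap, ⟪gradient (g i) z, ybar⟫ ≤ -ζ) :
    (∀ (t : ℝ) (lh : En m), IntFeasible φ g τ z l Ap t lh →
      ∑ i, Ap.indicator (fun i => |lh i|) i ≤
        ζ⁻¹ * (∑ j, |ybar j|) *
          ((⨆ j : Fin n, |(gradient φ z) j|) + (eta φ g z l) ^ τ)) ∧
    ∃ R : ℝ, ∀ (t : ℝ) (lh : En m), IntFeasible φ g τ z l Ap t lh → ‖lh‖ ≤ R := by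
  have hbound := fun (t : ℝ) (lh : En m) (h : IntFeasible φ g τ z l Ap t lh) =>
    h.sum_abs_le hζ hy
  exact ⟨fun t lh h => h.sum_indicator_abs.trans_le (hbound t lh h),
    _, fun t lh h => (norm_le_sum_abs lh).trans (hbound t lh h)⟩
end
end
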